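/- arXiv:2509.11528 — 5 statements merged into one kernel-verified Lean document; each statement's English description precedes it below -/
import Mathlib

section
/- Let n be a positive integer, T > 0, S an n×n real symmetric positive semidefinite matrix, and M : [0,T] → ℝ^{n×n} a continuous matrix-valued function. Suppose Q : [0,T] → ℝ^{n×n} is differentiable, Q(t) is symmetric for every t, Q satisfies the homogeneous matrix Riccati equation Q'(t) + Q(t) S Q(t) + Q(t) M(t) + M(t)ᵀ Q(t) = 0 for all t ∈ [0,T], and Q(T) is negative semidefinite. Then Q(t) is negative semidefinite for every t ∈ [0,T]. -/
open Matrix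

attribute [local instance] Matrix.normedAddCommGroup Matrix.normedSpace

/-- If `Q` is a symmetric solution of the Lyapunov equation `Q' = -(Q B + Bᵀ Q)` on `[a, b]` with
`B` continuous and `Q b` is negative semidefinite, then `Q` is negative semidefinite on `[a, b]`. -/
theorem negSemidef_of_lyapunov {ι : Type*} [Fintype ι] {a b : ℝ}
    {B Q : ℝ → Matrix ι ι ℝ} (hB : ContinuousOn B (Set.Icc a b))
    (hQsymm : ∀ t ∈ Set.Icc a b, (Q t).IsSymm)
    (hQode : ∀ t ∈ Set.Icc a b,
      HasDerivWithinAt Q (-(Q t * B t + (B t)ᵀ * Q t)) (Set.Icc a b) t)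
    (hQb : (-(Q b)).PosSemidef) :
    ∀ t ∈ Set.Icc a b, (-(Q t)).PosSemidef := by
  have hQ : ContinuousOn Q (Set.Icc a b) := fun t ht => (hQode t ht).continuousWithinAt
  let K : Set (ℝ × (ι → ℝ)) := Set.Icc a b ×ˢ Metric.sphere 0 1
  have hK : IsCompact K := isCompact_Icc.prod (isCompact_sphere 0 1)
  have hpos : ∀ p ∈ K, 0 < p.2 ⬝ᵥ p.2 := by
    intro p hp
    have h0 : p.2 ≠ 0 := ne_zero_of_mem_unit_sphere ⟨p.2, hp.2⟩
    simpa using dotProduct_star_self_pos_iff.2 h0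
  have hform : ∀ A : ℝ → Matrix ι ι ℝ, ContinuousOn A (Set.Icc a b) →
      ContinuousOn (fun p : ℝ × (ι → ℝ) => p.2 ⬝ᵥ A p.1 *ᵥ p.2) K := by
    intro A hA
    have hA' : ContinuousOn (fun p : ℝ × (ι → ℝ) => A p.1) K :=
      hA.comp continuousOn_fst fun p hp => hp.1
    have hfun : Continuous fun q : Matrix ι ι ℝ × (ι → ℝ) => q.2 ⬝ᵥ q.1 *ᵥ q.2 :=
      continuous_snd.dotProduct (continuous_fst.matrix_mulVec continuous_snd)
    exact hfun.comp_continuousOn (hA'.prodMk continuousOn_snd)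
  have hsq : ContinuousOn (fun p : ℝ × (ι → ℝ) => p.2 ⬝ᵥ p.2) K :=
    (continuous_snd.dotProduct continuous_snd).continuousOn
  obtain ⟨C, hC⟩ := (hK.image_of_continuousOn
    ((hform B hB).div hsq fun p hp => (hpos p hp).ne')).bddAbove
  replace hC : ∀ p ∈ K, p.2 ⬝ᵥ B p.1 *ᵥ p.2 ≤ C * (p.2 ⬝ᵥ p.2) := fun p hp =>
    (div_le_iff₀ (hpos p hp)).1 (hC (Set.mem_image_of_mem _ hp))
  let r : ℝ → ℝ := fun t => Real.exp ((2 * C + 1) * (b - t))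
  have hr : Continuous r := by fun_prop
  have hrpos : ∀ t, 0 < r t := fun t => Real.exp_pos _
  have hr' : ∀ t, HasDerivAt r (-(2 * C + 1) * r t) t := by
    intro t
    have := (((hasDerivAt_id t).const_sub b).const_mul (2 * C + 1)).exp
    refine this.congr_deriv ?_
    change Real.exp ((2 * C + 1) * (b - t)) * ((2 * C + 1) * -1) =
      -(2 * C + 1) * Real.exp ((2 * C + 1) * (b - t))
    ring
  have key : ∀ ε > 0, ∀ p ∈ K, p.2 ⬝ᵥ Q p.1 *ᵥ p.2 < ε * r p.1 * (p.2 ⬝ᵥ p.2) := by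
    intro ε hε
    by_contra! hne
    let L : Set (ℝ × (ι → ℝ)) :=
      {p ∈ K | ε * r p.1 * (p.2 ⬝ᵥ p.2) ≤ p.2 ⬝ᵥ Q p.1 *ᵥ p.2}
    have hL : IsCompact L := by
      refine hK.of_isClosed_subset ?_ fun p hp => hp.1
      refine hK.isClosed.isClosed_le ?_ (hform Q hQ)
      exact ((continuous_const.mul (hr.comp continuous_fst)).continuousOn).mul hsq
    obtain ⟨⟨s, x⟩, ⟨hp, hle⟩, hmax⟩ := hL.exists_isMaxOn hne continuousOn_fst
    have hs : s ∈ Set.Icc a b := hp.1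
    have hx : 0 < x ⬝ᵥ x := hpos _ hp
    have hlt : ∀ t ∈ Set.Ioc s b, ∀ y ∈ Metric.sphere (0 : ι → ℝ) 1,
        y ⬝ᵥ Q t *ᵥ y < ε * r t * (y ⬝ᵥ y) := by
      intro t ht y hy
      by_contra! h
      have h' := hmax (show (t, y) ∈ L from ⟨⟨⟨hs.1.trans ht.1.le, ht.2⟩, hy⟩, h⟩)
      exact absurd ht.1 (not_lt.2 h')
    have hsb : s < b := by
      refine lt_of_le_of_ne hs.2 fun h => ?_
      have h1 := hQb.dotProduct_mulVec_nonneg x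
      simp only [star_trivial, neg_mulVec, dotProduct_neg] at h1
      have h2 : 0 < ε * r s * (x ⬝ᵥ x) := mul_pos (mul_pos hε (hrpos s)) hx
      simp only [h] at hle h2
      linarith
    have hsub : Set.Ioc s b ⊆ Set.Icc a b := fun t ht => ⟨hs.1.trans ht.1.le, ht.2⟩
    have : (nhdsWithin s (Set.Ioc s b)).NeBot := by
      rw [nhdsWithin_Ioc_eq_nhdsGT hsb]; infer_instance
    have hderiv : ∀ y : ι → ℝ, HasDerivWithinAt (fun t => y ⬝ᵥ Q t *ᵥ y - ε * r t * (y ⬝ᵥ y))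
        (y ⬝ᵥ (-(Q s * B s + (B s)ᵀ * Q s)) *ᵥ y - ε * (-(2 * C + 1) * r s) * (y ⬝ᵥ y))
        (Set.Ioc s b) s := by
      intro y
      refine HasDerivWithinAt.sub ?_ ((((hr' s).const_mul ε).mul_const _).hasDerivWithinAt)
      have h := (hQode s hs).mono hsub
      have h' := fun i j => hasDerivWithinAt_pi.1 (hasDerivWithinAt_pi.1 h i) j
      simp only [dotProduct, mulVec]
      exact HasDerivWithinAt.fun_sum fun i _ => HasDerivWithinAt.const_mul _
        (HasDerivWithinAt.fun_sum fun j _ => (h' i j).mul_const _)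
    have hle' : ∀ y ∈ Metric.sphere (0 : ι → ℝ) 1,
        y ⬝ᵥ Q s *ᵥ y - ε * r s * (y ⬝ᵥ y) ≤ 0 := fun y hy =>
      le_of_tendsto (hderiv y).continuousWithinAt.tendsto
        (eventually_mem_nhdsWithin.mono fun t ht => (sub_neg.2 (hlt t ht y hy)).le)
    have heq : x ⬝ᵥ Q s *ᵥ x = ε * r s * (x ⬝ᵥ x) :=
      le_antisymm (sub_nonpos.1 (hle' x hp.2)) hle
    classical
    have hpsd : ((ε * r s) • (1 : Matrix ι ι ℝ) - Q s).PosSemidef := by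
      refine PosSemidef.of_dotProduct_mulVec_nonneg ?_ fun y => ?_
      · simp [IsHermitian, conjTranspose_eq_transpose_of_trivial, (hQsymm s hs).eq]
      · rcases eq_or_ne y 0 with rfl | hy
        · simp
        · have hn : 0 < ‖y‖ := norm_pos_iff.2 hy
          have h := hle' (‖y‖⁻¹ • y) (by simp [norm_smul, hn.ne'])
          simp only [mulVec_smul, dotProduct_smul, smul_dotProduct, smul_eq_mul] at h
          simp only [star_trivial, sub_mulVec, smul_mulVec, one_mulVec, dotProduct_sub,
            dotProduct_smul, smul_eq_mul]
          have h2 : ‖y‖⁻¹ * ‖y‖⁻¹ * (y ⬝ᵥ Q s *ᵥ y - ε * r s * (y ⬝ᵥ y)) ≤ 0 := by linarith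
          have h3 := nonpos_of_mul_nonpos_right h2 (by positivity)
          linarith
    have hev : Q s *ᵥ x = (ε * r s) • x := by
      have h := (hpsd.dotProduct_mulVec_zero_iff x).1 (by
        simp [sub_mulVec, smul_mulVec, dotProduct_sub, heq])
      rw [sub_mulVec, smul_mulVec, one_mulVec, sub_eq_zero] at h
      exact h.symm
    have h1 : x ⬝ᵥ (Q s * B s) *ᵥ x = ε * r s * (x ⬝ᵥ B s *ᵥ x) := by
      rw [← mulVec_mulVec, dotProduct_mulVec, ← mulVec_transpose, (hQsymm s hs).eq, hev,
        smul_dotProduct, smul_eq_mul]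
    have h2 : x ⬝ᵥ ((B s)ᵀ * Q s) *ᵥ x = ε * r s * (x ⬝ᵥ B s *ᵥ x) := by
      rw [← mulVec_mulVec, hev, mulVec_smul, dotProduct_smul, dotProduct_mulVec,
        vecMul_transpose, dotProduct_comm, smul_eq_mul]
    have hd : 0 < x ⬝ᵥ (-(Q s * B s + (B s)ᵀ * Q s)) *ᵥ x
        - ε * (-(2 * C + 1) * r s) * (x ⬝ᵥ x) := by
      rw [neg_mulVec, add_mulVec, dotProduct_neg, dotProduct_add, h1, h2]
      have hCx : x ⬝ᵥ B s *ᵥ x ≤ C * (x ⬝ᵥ x) := hC _ hp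
      have h3 : 0 < ε * r s := mul_pos hε (hrpos s)
      have h4 : 0 < ε * r s * (2 * (C * (x ⬝ᵥ x) - x ⬝ᵥ B s *ᵥ x) + x ⬝ᵥ x) :=
        mul_pos h3 (by linarith)
      linarith
    have hslope := (hasDerivWithinAt_iff_tendsto_slope' (by simp)).1 (hderiv x)
    obtain ⟨t, hpos', ht⟩ :=
      ((hslope.eventually_const_lt hd).and eventually_mem_nhdsWithin).exists
    have hneg := sub_neg.2 (hlt t ht x hp.2)
    rw [slope_def_field, heq, sub_self, sub_zero] at hpos'
    exact absurd hpos' (div_neg_of_neg_of_pos hneg (sub_pos.2 ht.1)).not_gt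
  intro t ht
  refine PosSemidef.of_dotProduct_mulVec_nonneg ?_ fun y => ?_
  · simp [IsHermitian, conjTranspose_eq_transpose_of_trivial, (hQsymm t ht).eq]
  · rcases eq_or_ne y 0 with rfl | hy
    · simp
    · have hn : 0 < ‖y‖ := norm_pos_iff.2 hy
      let z := ‖y‖⁻¹ • y
      have hz : (t, z) ∈ K := ⟨ht, by simp [z, norm_smul, hn.ne']⟩
      have h : z ⬝ᵥ Q t *ᵥ z ≤ 0 := by
        refine le_of_forall_pos_le_add fun δ hδ => ?_
        have hc : 0 < r t * (z ⬝ᵥ z) := mul_pos (hrpos t) (hpos _ hz)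
        have := key (δ / (r t * (z ⬝ᵥ z))) (div_pos hδ hc) _ hz
        rw [mul_assoc, div_mul_cancel₀ _ hc.ne'] at this
        linarith
      simp only [z, mulVec_smul, dotProduct_smul, smul_dotProduct, smul_eq_mul, ← mul_assoc] at h
      have h3 := nonpos_of_mul_nonpos_right h (by positivity)
      simpa [neg_mulVec] using h3

/-- Backward propagation of negative semidefiniteness for the homogeneous
matrix Riccati equation `Q'(t) + Q(t) S Q(t) + Q(t) M(t) + M(t)ᵀ Q(t) = 0` on `[0,T]`:
if `S ⪰ 0` is symmetric, `M` is continuous, each `Q(t)` is symmetric, and `Q(T)` is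
negative semidefinite, then `Q(t)` is negative semidefinite for every `t ∈ [0,T]`. -/
theorem homogeneous_riccati_negSemidef_propagation {n : ℕ} (hn : 0 < n)
    (T : ℝ) (hT : 0 < T)
    (S : Matrix (Fin n) (Fin n) ℝ) (hS : S.PosSemidef)
    (M : ℝ → Matrix (Fin n) (Fin n) ℝ) (hM : ContinuousOn M (Set.Icc 0 T))
    (Q : ℝ → Matrix (Fin n) (Fin n) ℝ)
    (hQsymm : ∀ t ∈ Set.Icc (0:ℝ) T, (Q t).IsSymm)
    (hQode : ∀ t ∈ Set.Icc (0:ℝ) T,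
      HasDerivWithinAt Q (-(Q t * S * Q t + Q t * M t + (M t)ᵀ * Q t)) (Set.Icc 0 T) t)
    (hQT : (-(Q T)).PosSemidef) :
    ∀ t ∈ Set.Icc (0:ℝ) T, (-(Q t)).PosSemidef := by
  have hQ : ContinuousOn Q (Set.Icc 0 T) := fun t ht => (hQode t ht).continuousWithinAt
  have hB : ContinuousOn (fun t => M t + (1 / 2 : ℝ) • (S * Q t)) (Set.Icc 0 T) := by
    have hmul : Continuous fun A : Matrix (Fin n) (Fin n) ℝ => S * A :=
      continuous_const.matrix_mul continuous_id
    exact hM.add ((hmul.comp_continuousOn hQ).const_smul (1 / 2 : ℝ))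
  refine negSemidef_of_lyapunov hB hQsymm (fun t ht => ?_) hQT
  have hSsymm : Sᵀ = S := by
    simpa [conjTranspose_eq_transpose_of_trivial] using hS.isHermitian.eq
  convert hQode t ht using 2
  rw [transpose_add, transpose_smul, transpose_mul, hSsymm, (hQsymm t ht).eq, mul_add, add_mul,
    mul_smul_comm, smul_mul_assoc, ← mul_assoc]
  module
end

section
/- Let n be a positive integer, T > 0, S an n×n real symmetric positive semidefinite matrix, R : [0,T] → ℝ^{n×n} and M : [0,T] → ℝ^{n×n} continuous matrix-valued functions with R(t) symmetric for every t. Suppose A, B : [0,T] → ℝ^{n×n} are differentiable, A(t) and B(t) are symmetric for every t, both solve the matrix Riccati equation X'(t) + R(t) + X(t) S X(t) + X(t) M(t) + M(t)ᵀ X(t) = 0 on [0,T], and B(T) − A(T) is negative semidefinite. Then B(t) − A(t) is negative semidefinite for every t ∈ [0,T]. -/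
open Matrix

attribute [local instance] Matrix.normedAddCommGroup Matrix.normedSpace

/-- The quadratic form of a matrix is jointly continuous in the matrix and the vector. -/
lemma continuous_quadraticForm {n : ℕ} :
    Continuous fun q : Matrix (Fin n) (Fin n) ℝ × (Fin n → ℝ) => q.2 ⬝ᵥ (q.1 *ᵥ q.2) :=
  continuous_snd.dotProduct (continuous_fst.matrix_mulVec continuous_snd)

lemma continuousOn_quadraticForm {n : ℕ} {P : ℝ → Matrix (Fin n) (Fin n) ℝ} {s : Set ℝ}
    (hP : ContinuousOn P s) (u : Set (Fin n → ℝ)) :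
    ContinuousOn (fun p : ℝ × (Fin n → ℝ) => p.2 ⬝ᵥ (P p.1 *ᵥ p.2)) (s ×ˢ u) :=
  continuous_quadraticForm.comp_continuousOn
    ((hP.comp continuousOn_fst fun _ hp => hp.1).prodMk continuousOn_snd)

lemma HasDerivWithinAt.quadraticForm {n : ℕ} {P : ℝ → Matrix (Fin n) (Fin n) ℝ}
    {P' : Matrix (Fin n) (Fin n) ℝ} {s : Set ℝ} {t : ℝ} (h : HasDerivWithinAt P P' s t)
    (x : Fin n → ℝ) :
    HasDerivWithinAt (fun τ => x ⬝ᵥ (P τ *ᵥ x)) (x ⬝ᵥ (P' *ᵥ x)) s t := by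
  let L : Matrix (Fin n) (Fin n) ℝ →ₗ[ℝ] ℝ :=
    { toFun := fun Q => x ⬝ᵥ (Q *ᵥ x)
      map_add' := fun Q Q' => by rw [add_mulVec, dotProduct_add]
      map_smul' := fun c Q => by rw [smul_mulVec, dotProduct_smul]; rfl }
  exact (LinearMap.toContinuousLinearMap L).hasFDerivAt.comp_hasDerivWithinAt t h

lemma isCompact_setOf_dotProduct_self_eq_one (n : ℕ) :
    IsCompact {x : Fin n → ℝ | x ⬝ᵥ x = 1} := by
  refine (isCompact_closedBall (0 : Fin n → ℝ) 1).of_isClosed_subset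
    (isClosed_eq (continuous_id.dotProduct continuous_id) continuous_const) fun x hx => ?_
  rw [mem_closedBall_zero_iff, pi_norm_le_iff_of_nonneg zero_le_one]
  intro i
  rw [Real.norm_eq_abs, ← sq_le_one_iff_abs_le_one, ← show x ⬝ᵥ x = 1 from hx, sq]
  exact Finset.single_le_sum (f := fun j => x j * x j) (fun j _ => mul_self_nonneg _)
    (Finset.mem_univ i)

/-- A symmetric matrix with nonnegative quadratic form on the unit sphere is positive
semidefinite. -/
lemma posSemidef_of_unit_nonneg {n : ℕ} {P : Matrix (Fin n) (Fin n) ℝ} (hP : P.IsSymm)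
    (h : ∀ x : Fin n → ℝ, x ⬝ᵥ x = 1 → 0 ≤ x ⬝ᵥ (P *ᵥ x)) : P.PosSemidef := by
  refine PosSemidef.of_dotProduct_mulVec_nonneg
    (by rwa [IsHermitian, conjTranspose_eq_transpose_of_trivial]) fun x => ?_
  rw [star_trivial]
  by_cases hx : x = 0
  · simp [hx]
  have hpos : 0 < x ⬝ᵥ x := by
    simpa using dotProduct_star_self_pos_iff.mpr hx
  have hs := Real.sq_sqrt hpos.le
  have hs0 := Real.sqrt_pos.mpr hpos
  set r := √(x ⬝ᵥ x)
  have h1 := h (r⁻¹ • x) (by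
    simp only [smul_dotProduct, dotProduct_smul, smul_eq_mul]
    rw [← hs]; field_simp)
  simp only [mulVec_smul, smul_dotProduct, dotProduct_smul, smul_eq_mul] at h1
  have h2 : 0 ≤ r * (r * (r⁻¹ * (r⁻¹ * x ⬝ᵥ (P *ᵥ x)))) := by positivity
  rwa [mul_inv_cancel_left₀ hs0.ne', mul_inv_cancel_left₀ hs0.ne'] at h2

/-- A function on `[a, b]` that vanishes at `t < b` and is positive to the right of `t` cannot
have a negative derivative at `t`. -/
lemma nonneg_of_hasDerivWithinAt_of_pos_right {f : ℝ → ℝ} {f' a b t : ℝ}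
    (ht : t ∈ Set.Icc a b) (htb : t < b) (hf : HasDerivWithinAt f f' (Set.Icc a b) t)
    (h0 : f t = 0) (hpos : ∀ τ ∈ Set.Ioc t b, 0 < f τ) : 0 ≤ f' := by
  have h1 : HasDerivWithinAt f f' (Set.Ioc t b) t :=
    hf.mono fun τ hτ => ⟨ht.1.trans hτ.1.le, hτ.2⟩
  rw [hasDerivWithinAt_iff_tendsto_slope' (by simp)] at h1
  have : (nhdsWithin t (Set.Ioc t b)).NeBot := by
    rw [nhdsWithin_Ioc_eq_nhdsGT htb]; infer_instance
  refine ge_of_tendsto h1 (eventually_nhdsWithin_of_forall fun τ hτ => ?_)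
  rw [slope_def_field, h0, sub_zero]
  exact div_nonneg (hpos τ hτ).le (sub_nonneg.mpr hτ.1.le)

/-- Solutions of a Lyapunov equation `D' = -(D K + Kᵀ D)` that are positive semidefinite at the
terminal time are positive semidefinite throughout. -/
lemma posSemidef_of_lyapunov {n : ℕ} {T : ℝ} {K D : ℝ → Matrix (Fin n) (Fin n) ℝ}
    (hK : ContinuousOn K (Set.Icc 0 T)) (hD : ∀ t ∈ Set.Icc (0 : ℝ) T, (D t).IsSymm)
    (hode : ∀ t ∈ Set.Icc (0 : ℝ) T,
      HasDerivWithinAt D (-(D t * K t + (K t)ᵀ * D t)) (Set.Icc 0 T) t)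
    (hT : (D T).PosSemidef) : ∀ t ∈ Set.Icc (0 : ℝ) T, (D t).PosSemidef := by
  have hDc : ContinuousOn D (Set.Icc 0 T) := fun t ht => (hode t ht).continuousWithinAt
  have hcpt : IsCompact (Set.Icc (0 : ℝ) T ×ˢ {x : Fin n → ℝ | x ⬝ᵥ x = 1}) :=
    isCompact_Icc.prod (isCompact_setOf_dotProduct_self_eq_one n)
  obtain ⟨C, hC⟩ := hcpt.bddAbove_image (continuousOn_quadraticForm hK _)
  set c := 2 * C + 1 with hc
  -- The perturbed form stays positive on the unit sphere.
  have key : ∀ ε > 0, ∀ t ∈ Set.Icc (0 : ℝ) T, ∀ x : Fin n → ℝ, x ⬝ᵥ x = 1 →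
      0 < x ⬝ᵥ (D t *ᵥ x) + ε * Real.exp (c * (T - t)) := by
    intro ε hε
    by_contra! hbad
    obtain ⟨t₁, ht₁, x₁, hx₁, hle₁⟩ := hbad
    set e : ℝ → ℝ := fun t => ε * Real.exp (c * (T - t)) with he
    have he_pos : ∀ t, 0 < e t := fun t => mul_pos hε (Real.exp_pos _)
    have he_cont : Continuous e := by fun_prop
    have he_deriv : ∀ t, HasDerivAt e (-c * e t) t := by
      intro t
      have h := ((((hasDerivAt_id t).const_sub T).const_mul c).exp).const_mul ε
      refine h.congr_deriv ?_
      simp only [he, id]; ring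
    have hF : ContinuousOn (fun p : ℝ × (Fin n → ℝ) => p.2 ⬝ᵥ (D p.1 *ᵥ p.2) + e p.1)
        (Set.Icc (0 : ℝ) T ×ˢ {x : Fin n → ℝ | x ⬝ᵥ x = 1}) :=
      (continuousOn_quadraticForm hDc _).add (he_cont.comp continuous_fst).continuousOn
    have hZ : IsCompact ((Set.Icc (0 : ℝ) T ×ˢ {x : Fin n → ℝ | x ⬝ᵥ x = 1}) ∩
        (fun p : ℝ × (Fin n → ℝ) => p.2 ⬝ᵥ (D p.1 *ᵥ p.2) + e p.1) ⁻¹' Set.Iic 0) :=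
      hcpt.of_isClosed_subset (hF.preimage_isClosed_of_isClosed hcpt.isClosed isClosed_Iic)
        Set.inter_subset_left
    obtain ⟨t, ⟨⟨⟨_, x⟩, ⟨⟨ht, hx⟩, hle⟩, rfl⟩, hmax⟩⟩ :=
      (hZ.image continuous_fst).exists_isGreatest
        ⟨t₁, (t₁, x₁), ⟨⟨ht₁, hx₁⟩, hle₁⟩, rfl⟩
    rename_i t
    simp only [Set.mem_preimage, Set.mem_Iic, Set.mem_ofPred_eq] at ht hx hle hmax
    have hright : ∀ τ ∈ Set.Ioc t T, ∀ y : Fin n → ℝ, y ⬝ᵥ y = 1 →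
        0 < y ⬝ᵥ (D τ *ᵥ y) + e τ := by
      intro τ hτ y hy
      by_contra! hneg
      exact hτ.1.not_ge
        (hmax ⟨(τ, y), ⟨⟨⟨ht.1.trans hτ.1.le, hτ.2⟩, hy⟩, hneg⟩, rfl⟩)
    have htT : t < T := by
      refine lt_of_le_of_ne ht.2 fun h => ?_
      have := hT.dotProduct_mulVec_nonneg x
      rw [star_trivial, ← h] at this
      linarith [he_pos t]
    have hform : ∀ y : Fin n → ℝ, y ⬝ᵥ y = 1 →
        y ⬝ᵥ ((D t + e t • (1 : Matrix (Fin n) (Fin n) ℝ)) *ᵥ y) = y ⬝ᵥ (D t *ᵥ y) + e t := by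
      intro y hy
      rw [add_mulVec, smul_mulVec, one_mulVec, dotProduct_add, dotProduct_smul, hy, smul_eq_mul,
        mul_one]
    have hpsd : (D t + e t • (1 : Matrix (Fin n) (Fin n) ℝ)).PosSemidef := by
      refine posSemidef_of_unit_nonneg ((hD t ht).add (isSymm_one.smul _)) fun y hy => ?_
      rw [hform y hy]
      have hcont : ContinuousWithinAt (fun τ => y ⬝ᵥ (D τ *ᵥ y) + e τ) (Set.Ioc t T) t :=
        (((hode t ht).quadraticForm y).continuousWithinAt.add
          he_cont.continuousWithinAt).mono fun τ hτ => ⟨ht.1.trans hτ.1.le, hτ.2⟩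
      have : (nhdsWithin t (Set.Ioc t T)).NeBot := by
        rw [nhdsWithin_Ioc_eq_nhdsGT htT]; infer_instance
      exact ge_of_tendsto hcont
        (eventually_nhdsWithin_of_forall fun τ hτ => (hright τ hτ y hy).le)
    have hzero : x ⬝ᵥ (D t *ᵥ x) + e t = 0 := by
      refine le_antisymm hle ?_
      have := hpsd.dotProduct_mulVec_nonneg x
      rwa [star_trivial, hform x hx] at this
    have hker : D t *ᵥ x = -(e t • x) := by
      have := (hpsd.dotProduct_mulVec_zero_iff x).mp (by rw [star_trivial, hform x hx, hzero])
      rw [add_mulVec, smul_mulVec, one_mulVec] at this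
      exact eq_neg_of_add_eq_zero_left this
    have hderiv := nonneg_of_hasDerivWithinAt_of_pos_right ht htT
      (((hode t ht).quadraticForm x).add (he_deriv t).hasDerivWithinAt) hzero
      fun τ hτ => hright τ hτ x hx
    have hker' : x ᵥ* D t = -(e t • x) := by
      rw [← mulVec_transpose, (hD t ht).eq, hker]
    have hcomp : x ⬝ᵥ (-(D t * K t + (K t)ᵀ * D t) *ᵥ x) = 2 * e t * (x ⬝ᵥ (K t *ᵥ x)) := by
      have hKt : x ⬝ᵥ ((K t)ᵀ *ᵥ x) = x ⬝ᵥ (K t *ᵥ x) := by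
        rw [mulVec_transpose, dotProduct_comm, ← dotProduct_mulVec]
      rw [neg_mulVec, add_mulVec, ← mulVec_mulVec, ← mulVec_mulVec, hker, dotProduct_neg,
        dotProduct_add, dotProduct_mulVec x (D t), hker', mulVec_neg, mulVec_smul,
        neg_dotProduct, dotProduct_neg, smul_dotProduct, dotProduct_smul, hKt, smul_eq_mul]
      ring
    have hCx : x ⬝ᵥ (K t *ᵥ x) ≤ C := hC ⟨(t, x), ⟨ht, hx⟩, rfl⟩
    rw [hcomp] at hderiv
    nlinarith [he_pos t, mul_le_mul_of_nonneg_left hCx (he_pos t).le]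
  intro t ht
  refine posSemidef_of_unit_nonneg (hD t ht) fun x hx => ?_
  by_contra! hneg
  have h := key (-(x ⬝ᵥ (D t *ᵥ x)) / Real.exp (c * (T - t)))
    (div_pos (neg_pos.mpr hneg) (Real.exp_pos _)) t ht x hx
  rw [div_mul_cancel₀ _ (Real.exp_pos _).ne'] at h
  linarith

/-- Comparison theorem for the matrix Riccati equation
`X'(t) + R(t) + X(t) S X(t) + X(t) M(t) + M(t)ᵀ X(t) = 0` on `[0,T]`:
if `S ⪰ 0` is symmetric, `R` and `M` are continuous with `R(t)` symmetric, the symmetric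
solutions `A` and `B` satisfy the equation, and `B(T) − A(T)` is negative semidefinite,
then `B(t) − A(t)` is negative semidefinite for every `t ∈ [0,T]`. -/
theorem riccati_comparison_terminal_order {n : ℕ} (hn : 0 < n)
    (T : ℝ) (hT : 0 < T)
    (S : Matrix (Fin n) (Fin n) ℝ) (hS : S.PosSemidef)
    (R M : ℝ → Matrix (Fin n) (Fin n) ℝ)
    (hR : ContinuousOn R (Set.Icc 0 T)) (hM : ContinuousOn M (Set.Icc 0 T))
    (hRsymm : ∀ t ∈ Set.Icc (0:ℝ) T, (R t).IsSymm)
    (A B : ℝ → Matrix (Fin n) (Fin n) ℝ)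
    (hAsymm : ∀ t ∈ Set.Icc (0:ℝ) T, (A t).IsSymm)
    (hBsymm : ∀ t ∈ Set.Icc (0:ℝ) T, (B t).IsSymm)
    (hAode : ∀ t ∈ Set.Icc (0:ℝ) T,
      HasDerivWithinAt A (-(R t + A t * S * A t + A t * M t + (M t)ᵀ * A t)) (Set.Icc 0 T) t)
    (hBode : ∀ t ∈ Set.Icc (0:ℝ) T,
      HasDerivWithinAt B (-(R t + B t * S * B t + B t * M t + (M t)ᵀ * B t)) (Set.Icc 0 T) t)
    (hterm : (-(B T - A T)).PosSemidef) :
    ∀ t ∈ Set.Icc (0:ℝ) T, (-(B t - A t)).PosSemidef := by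
  have hAc : ContinuousOn A (Set.Icc 0 T) := fun t ht => (hAode t ht).continuousWithinAt
  have hBc : ContinuousOn B (Set.Icc 0 T) := fun t ht => (hBode t ht).continuousWithinAt
  have hSsymm : Sᵀ = S := by
    rw [← conjTranspose_eq_transpose_of_trivial]; exact hS.isHermitian
  -- The difference `A - B` solves a linear equation with coefficient `M + S (A + B) / 2`.
  have hK : ContinuousOn (fun t => M t + (1 / 2 : ℝ) • (S * (A t + B t))) (Set.Icc 0 T) :=
    hM.add ((show Continuous fun X : Matrix (Fin n) (Fin n) ℝ => (1 / 2 : ℝ) • (S * X) by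
      fun_prop).comp_continuousOn (hAc.add hBc))
  simp only [neg_sub] at hterm ⊢
  refine posSemidef_of_lyapunov (D := fun t => A t - B t) hK
    (fun t ht => (hAsymm t ht).sub (hBsymm t ht)) (fun t ht => ?_) hterm
  refine ((hAode t ht).sub (hBode t ht)).congr_deriv ?_
  have hA := (hAsymm t ht).eq
  have hB := (hBsymm t ht).eq
  simp only [transpose_add, transpose_smul, transpose_mul, hA, hB, hSsymm, mul_add, add_mul,
    sub_mul, mul_sub, mul_smul_comm, smul_mul_assoc, smul_add, smul_sub, Matrix.mul_assoc]
  module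
end

section
/- Let γ > 1, let L^S ∈ ℝ^{N×N'} with Σ^S := L^S(L^S)ᵀ positive definite, L^X ∈ ℝ^{d×N'}, Σ^X := L^X(L^X)ᵀ, Σ^{S,X} := L^S(L^X)ᵀ, let β be an N×d real matrix, Θ a d×d real matrix, P a K×d real matrix, and T > 0. For i ∈ {1,2} let Ω_i be a K×K real symmetric positive definite matrix and let A^{(i)} : [0,T] → ℝ^{d×d} be a differentiable symmetric-matrix-valued solution of the Riccati equation A'(t) + ((1−γ)/γ) βᵀ(Σ^S)⁻¹β + A(t)(Σ^X + ((1−γ)/γ)(Σ^{S,X})ᵀ(Σ^S)⁻¹Σ^{S,X})A(t) + A(t)(((1−γ)/γ)(Σ^{S,X})ᵀ(Σ^S)⁻¹β − Θ) + (((1−γ)/γ)(Σ^{S,X})ᵀ(Σ^S)⁻¹β − Θ)ᵀA(t) = 0 with terminal condition A^{(i)}(T) = −Pᵀ Ω_i⁻¹ P. Then each A^{(i)}(t) is negative semidefinite for all t ∈ [0,T], and if Ω_1⁻¹ − Ω_2⁻¹ is positive semidefinite then A^{(1)}(t) − A^{(2)}(t) is negative semidefinite for all t ∈ [0,T]. 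-/
open Matrix

attribute [local instance] Matrix.normedAddCommGroup Matrix.normedSpace

lemma hasDerivWithinAt_dotProduct_mulVec {n : Type*} [Fintype n] {F : ℝ → Matrix n n ℝ}
    {F' : Matrix n n ℝ} {s : Set ℝ} {t : ℝ} (hF : HasDerivWithinAt F F' s t) (v : n → ℝ) :
    HasDerivWithinAt (fun u => v ⬝ᵥ F u *ᵥ v) (v ⬝ᵥ F' *ᵥ v) s t := by
  simp only [dotProduct, mulVec]
  refine HasDerivWithinAt.fun_sum fun i _ => HasDerivWithinAt.const_mul _ ?_
  refine HasDerivWithinAt.fun_sum fun j _ => HasDerivWithinAt.mul_const ?_ _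
  exact hasDerivWithinAt_pi.1 (hasDerivWithinAt_pi.1 hF i) j

/-- A symmetric solution of the Lyapunov inequality `F' + F C + Cᵀ F ⪯ 0` which is positive
semidefinite at the terminal time is positive semidefinite at all earlier times. -/
theorem posSemidef_of_lyapunov_s9 {n : Type*} [Fintype n] {T : ℝ}
    {F C R : ℝ → Matrix n n ℝ}
    (hsymm : ∀ t ∈ Set.Icc (0 : ℝ) T, (F t).IsSymm)
    (hC : ContinuousOn C (Set.Icc 0 T))
    (hR : ∀ t ∈ Set.Icc (0 : ℝ) T, (R t).PosSemidef)
    (hF : ∀ t ∈ Set.Icc (0 : ℝ) T,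
      HasDerivWithinAt F (-(R t + F t * C t + (C t)ᵀ * F t)) (Set.Icc 0 T) t)
    (hT : (F T).PosSemidef) :
    ∀ t ∈ Set.Icc (0 : ℝ) T, (F t).PosSemidef := by
  have hFc : ContinuousOn F (Set.Icc 0 T) := fun t ht => (hF t ht).continuousWithinAt
  have hcomp : IsCompact (Set.Icc (0 : ℝ) T ×ˢ Metric.sphere (0 : n → ℝ) 1) :=
    isCompact_Icc.prod (isCompact_sphere _ _)
  have hsq : ∀ v : n → ℝ, v ≠ 0 → 0 < v ⬝ᵥ v := fun v hv => by
    simpa using dotProduct_star_self_pos_iff.2 hv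
  have hne : ∀ v ∈ Metric.sphere (0 : n → ℝ) 1, v ≠ 0 := fun v hv h => by simp [h] at hv
  obtain ⟨L, hL⟩ : ∃ L : ℝ, ∀ t ∈ Set.Icc (0 : ℝ) T, ∀ v ∈ Metric.sphere (0 : n → ℝ) 1,
      2 * (v ⬝ᵥ C t *ᵥ v) < L * (v ⬝ᵥ v) := by
    have hcont : ContinuousOn (fun p : ℝ × (n → ℝ) => 2 * (p.2 ⬝ᵥ C p.1 *ᵥ p.2) / (p.2 ⬝ᵥ p.2))
        (Set.Icc (0 : ℝ) T ×ˢ Metric.sphere (0 : n → ℝ) 1) := by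
      have h1 : ContinuousOn (fun p : ℝ × (n → ℝ) => C p.1)
          (Set.Icc (0 : ℝ) T ×ˢ Metric.sphere (0 : n → ℝ) 1) :=
        hC.comp continuousOn_fst fun p hp => hp.1
      rw [continuousOn_iff_continuous_domRestrict] at h1 ⊢
      refine Continuous.div (continuous_const.mul (Continuous.dotProduct (by fun_prop)
        (Continuous.matrix_mulVec h1 (by fun_prop))))
        (Continuous.dotProduct (by fun_prop) (by fun_prop)) ?_
      exact fun p => (hsq _ (hne _ p.2.2)).ne'
    obtain ⟨L, hL⟩ := hcomp.bddAbove_image hcont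
    refine ⟨L + 1, fun t ht v hv => ?_⟩
    have := hL ⟨(t, v), ⟨ht, hv⟩, rfl⟩
    have hp := hsq v (hne v hv)
    rw [div_le_iff₀ hp] at this
    dsimp only at this
    linarith
  have key : ∀ ε > 0, ∀ t ∈ Set.Icc (0 : ℝ) T, ∀ v ∈ Metric.sphere (0 : n → ℝ) 1,
      0 < v ⬝ᵥ F t *ᵥ v + ε * Real.exp (L * (T - t)) * (v ⬝ᵥ v) := by
    intro ε hε
    set q : ℝ → (n → ℝ) → ℝ := fun t v =>
      v ⬝ᵥ F t *ᵥ v + ε * Real.exp (L * (T - t)) * (v ⬝ᵥ v) with hq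
    by_contra! hcon
    obtain ⟨t₀, ht₀, v₀, hv₀, hneg⟩ := hcon
    have hqcont : ContinuousOn (fun p : ℝ × (n → ℝ) => q p.1 p.2)
        (Set.Icc (0 : ℝ) T ×ˢ Metric.sphere (0 : n → ℝ) 1) := by
      have h1 : ContinuousOn (fun p : ℝ × (n → ℝ) => F p.1)
          (Set.Icc (0 : ℝ) T ×ˢ Metric.sphere (0 : n → ℝ) 1) :=
        hFc.comp continuousOn_fst fun p hp => hp.1
      rw [continuousOn_iff_continuous_domRestrict] at h1 ⊢
      refine Continuous.add (Continuous.dotProduct (by fun_prop)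
        (Continuous.matrix_mulVec h1 (by fun_prop))) (Continuous.mul (by fun_prop)
        (Continuous.dotProduct (by fun_prop) (by fun_prop)))
    have hZ : IsCompact ((Set.Icc (0 : ℝ) T ×ˢ Metric.sphere (0 : n → ℝ) 1) ∩
        (fun p : ℝ × (n → ℝ) => q p.1 p.2) ⁻¹' Set.Iic 0) :=
      hcomp.of_isClosed_subset
        (hqcont.preimage_isClosed_of_isClosed hcomp.isClosed isClosed_Iic) Set.inter_subset_left
    obtain ⟨⟨s, v⟩, ⟨⟨hs, hv⟩, hsv⟩, hmax⟩ :=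
      hZ.exists_isMaxOn ⟨(t₀, v₀), ⟨ht₀, hv₀⟩, hneg⟩ continuousOn_fst
    dsimp only at hs hv
    replace hsv : q s v ≤ 0 := hsv
    have hvv := hsq v (hne v hv)
    have hsT : s < T := by
      refine lt_of_le_of_ne hs.2 fun h => hsv.not_gt ?_
      have := hT.dotProduct_mulVec_nonneg v
      simp only [star_trivial] at this
      subst h
      have : 0 < ε * Real.exp (L * (s - s)) * (v ⬝ᵥ v) := by positivity
      simp only [hq]
      linarith
    have hpos : ∀ t ∈ Set.Ioc s T, ∀ w ∈ Metric.sphere (0 : n → ℝ) 1, 0 < q t w := by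
      intro t ht w hw
      by_contra! h
      exact ht.1.not_ge (hmax (a := (t, w)) ⟨⟨⟨hs.1.trans ht.1.le, ht.2⟩, hw⟩, h⟩)
    have hderiv : ∀ w : n → ℝ, HasDerivWithinAt (fun t => q t w)
        (w ⬝ᵥ (-(R s + F s * C s + (C s)ᵀ * F s)) *ᵥ w
          + ε * (Real.exp (L * (T - s)) * (L * (-1))) * (w ⬝ᵥ w)) (Set.Ioi s) s := by
      intro w
      have h1 := (hasDerivWithinAt_dotProduct_mulVec (hF s hs) w).mono_of_mem_nhdsWithin
        (s := Set.Ioi s) (Filter.mem_of_superset (Ioc_mem_nhdsGT hsT)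
          fun t ht => ⟨hs.1.trans ht.1.le, ht.2⟩)
      have h2 : HasDerivAt (fun t => Real.exp (L * (T - t)))
          (Real.exp (L * (T - s)) * (L * (-1))) s :=
        (((hasDerivAt_id s).const_sub T).const_mul L).exp
      exact h1.add ((h2.const_mul ε).mul_const (w ⬝ᵥ w)).hasDerivWithinAt
    have hnn : ∀ w ∈ Metric.sphere (0 : n → ℝ) 1, 0 ≤ q s w := fun w hw =>
      ge_of_tendsto (hderiv w).continuousWithinAt
        (Filter.mem_of_superset (Ioc_mem_nhdsGT hsT) fun t ht => (hpos t ht w hw).le)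
    have hsv0 : q s v = 0 := le_antisymm hsv (hnn v hv)
    set c := ε * Real.exp (L * (T - s)) with hc
    have hcpos : 0 < c := by positivity
    have hsymG : (F s)ᵀ = F s := hsymm s hs
    have hFv : F s *ᵥ v = -(c • v) := by
      classical
      have hG : (F s + c • (1 : Matrix n n ℝ)).PosSemidef := by
        refine PosSemidef.of_dotProduct_mulVec_nonneg ?_ fun w => ?_
        · simp [IsHermitian, conjTranspose_eq_transpose_of_trivial, hsymG]
        · by_cases hw : w = 0
          · simp [hw]
          have hw' : 0 < ‖w‖ := norm_pos_iff.2 hw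
          have := hnn (‖w‖⁻¹ • w) (by simp [norm_smul, hw'.ne'])
          have h3 : q s (‖w‖⁻¹ • w) = ‖w‖⁻¹ ^ 2 *
              (w ⬝ᵥ (F s + c • (1 : Matrix n n ℝ)) *ᵥ w) := by
            simp only [hq, mulVec_smul, dotProduct_smul, smul_dotProduct, smul_eq_mul, add_mulVec,
              smul_mulVec, one_mulVec, dotProduct_add, ← hc]
            ring
          rw [h3] at this
          simpa using nonneg_of_mul_nonneg_right this (by positivity)
      have h0 : star v ⬝ᵥ (F s + c • (1 : Matrix n n ℝ)) *ᵥ v = 0 := by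
        simpa [hq, add_mulVec, smul_mulVec] using hsv0
      have := (hG.dotProduct_mulVec_zero_iff v).1 h0
      rw [add_mulVec, smul_mulVec, one_mulVec] at this
      exact eq_neg_of_add_eq_zero_left this
    have hslope : 0 ≤ v ⬝ᵥ (-(R s + F s * C s + (C s)ᵀ * F s)) *ᵥ v
          + ε * (Real.exp (L * (T - s)) * (L * (-1))) * (v ⬝ᵥ v) := by
      refine ge_of_tendsto ((hasDerivWithinAt_iff_tendsto_slope' (by simp)).1 (hderiv v))
        (Filter.mem_of_superset (Ioc_mem_nhdsGT hsT) fun t ht => ?_)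
      simp only [Set.mem_ofPred_eq, slope_def_field, hsv0, sub_zero]
      exact div_nonneg (hpos t ht v hv).le (sub_nonneg.2 ht.1.le)
    have h1 : v ⬝ᵥ (F s * C s) *ᵥ v = -(c * (v ⬝ᵥ C s *ᵥ v)) := by
      rw [← mulVec_mulVec, dotProduct_mulVec, ← mulVec_transpose, hsymG, hFv]
      simp
    have h2 : v ⬝ᵥ ((C s)ᵀ * F s) *ᵥ v = -(c * (v ⬝ᵥ C s *ᵥ v)) := by
      rw [← mulVec_mulVec, hFv, mulVec_neg, mulVec_smul, mulVec_transpose, dotProduct_neg,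
        dotProduct_smul, dotProduct_comm, ← dotProduct_mulVec, smul_eq_mul]
    have h3 := (hR s hs).dotProduct_mulVec_nonneg v
    simp only [star_trivial] at h3
    rw [neg_mulVec, dotProduct_neg, add_mulVec, add_mulVec, dotProduct_add, dotProduct_add,
      h1, h2] at hslope
    have h4 := mul_lt_mul_of_pos_left (hL s hs v hv) hcpos
    have h5 : ε * (Real.exp (L * (T - s)) * (L * (-1))) * (v ⬝ᵥ v) = -(c * (L * (v ⬝ᵥ v))) := by
      rw [hc]; ring
    linarith
  intro t ht
  refine PosSemidef.of_dotProduct_mulVec_nonneg ?_ fun w => ?_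
  · rw [IsHermitian, conjTranspose_eq_transpose_of_trivial]
    exact hsymm t ht
  by_cases hw : w = 0
  · simp [hw]
  have hw' : 0 < ‖w‖ := norm_pos_iff.2 hw
  have hsph : ‖w‖⁻¹ • w ∈ Metric.sphere (0 : n → ℝ) 1 := by simp [norm_smul, hw'.ne']
  have hlim : 0 ≤ (‖w‖⁻¹ • w) ⬝ᵥ F t *ᵥ (‖w‖⁻¹ • w) := by
    set u := ‖w‖⁻¹ • w
    have hu := hsq u (hne u hsph)
    set a := Real.exp (L * (T - t)) * (u ⬝ᵥ u) with ha
    have hapos : 0 < a := by positivity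
    refine le_of_forall_pos_le_add fun δ hδ => ?_
    have := key (δ / a) (by positivity) t ht u hsph
    rw [mul_assoc, ← ha, div_mul_cancel₀ _ hapos.ne'] at this
    exact this.le
  rw [mulVec_smul, dotProduct_smul, smul_dotProduct, smul_eq_mul, smul_eq_mul] at hlim
  simpa using nonneg_of_mul_nonneg_right
    (nonneg_of_mul_nonneg_right hlim (by positivity)) (by positivity)

/-- A symmetric solution of the Riccati equation `A' + Q + A M A + A B + Bᵀ A = 0` with `Q ⪯ 0` and
negative semidefinite terminal value is negative semidefinite at all earlier times. -/
theorem posSemidef_neg_of_riccati {n : Type*} [Fintype n] {T : ℝ}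
    {A : ℝ → Matrix n n ℝ} {Q M B : Matrix n n ℝ}
    (hsymm : ∀ t ∈ Set.Icc (0 : ℝ) T, (A t).IsSymm) (hM : M.IsSymm) (hQ : (-Q).PosSemidef)
    (hA : ∀ t ∈ Set.Icc (0 : ℝ) T,
      HasDerivWithinAt A (-(Q + A t * M * A t + A t * B + Bᵀ * A t)) (Set.Icc 0 T) t)
    (hT : (-(A T)).PosSemidef) :
    ∀ t ∈ Set.Icc (0 : ℝ) T, (-(A t)).PosSemidef := by
  have hAc : ContinuousOn A (Set.Icc 0 T) := fun t ht => (hA t ht).continuousWithinAt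
  refine posSemidef_of_lyapunov_s9 (F := fun t => -(A t))
    (C := fun t => (1 / 2 : ℝ) • (M * A t) + B) (R := fun _ => -Q)
    (fun t ht => (hsymm t ht).neg) ?_ (fun _ _ => hQ) (fun t ht => ?_) hT
  · rw [continuousOn_iff_continuous_domRestrict] at hAc ⊢
    exact ((continuous_const.matrix_mul hAc).const_smul (1 / 2 : ℝ)).add continuous_const
  · refine (hA t ht).neg.congr_deriv ?_
    have h1 : (A t)ᵀ = A t := hsymm t ht
    have h2 : Mᵀ = M := hM
    simp only [transpose_add, transpose_smul, transpose_mul, h1, h2, Matrix.mul_add,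
      Matrix.add_mul, Matrix.mul_smul, Matrix.smul_mul, Matrix.neg_mul, Matrix.mul_neg,
      ← Matrix.mul_assoc]
    module

/-- Two symmetric solutions of the same Riccati equation keep, backwards in time, the Loewner order
of their terminal values. -/
theorem posSemidef_sub_of_riccati {n : Type*} [Fintype n] {T : ℝ}
    {A₁ A₂ : ℝ → Matrix n n ℝ} {Q M B : Matrix n n ℝ}
    (hsymm₁ : ∀ t ∈ Set.Icc (0 : ℝ) T, (A₁ t).IsSymm)
    (hsymm₂ : ∀ t ∈ Set.Icc (0 : ℝ) T, (A₂ t).IsSymm) (hM : M.IsSymm)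
    (hA₁ : ∀ t ∈ Set.Icc (0 : ℝ) T,
      HasDerivWithinAt A₁ (-(Q + A₁ t * M * A₁ t + A₁ t * B + Bᵀ * A₁ t)) (Set.Icc 0 T) t)
    (hA₂ : ∀ t ∈ Set.Icc (0 : ℝ) T,
      HasDerivWithinAt A₂ (-(Q + A₂ t * M * A₂ t + A₂ t * B + Bᵀ * A₂ t)) (Set.Icc 0 T) t)
    (hT : (A₂ T - A₁ T).PosSemidef) :
    ∀ t ∈ Set.Icc (0 : ℝ) T, (A₂ t - A₁ t).PosSemidef := by
  have hA₁c : ContinuousOn A₁ (Set.Icc 0 T) := fun t ht => (hA₁ t ht).continuousWithinAt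
  have hA₂c : ContinuousOn A₂ (Set.Icc 0 T) := fun t ht => (hA₂ t ht).continuousWithinAt
  refine posSemidef_of_lyapunov_s9 (F := fun t => A₂ t - A₁ t)
    (C := fun t => (1 / 2 : ℝ) • (M * (A₁ t + A₂ t)) + B) (R := fun _ => 0)
    (fun t ht => (hsymm₂ t ht).sub (hsymm₁ t ht)) ?_ (fun _ _ => PosSemidef.zero)
    (fun t ht => ?_) hT
  · rw [continuousOn_iff_continuous_domRestrict] at hA₁c hA₂c ⊢
    exact ((continuous_const.matrix_mul (hA₁c.add hA₂c)).const_smul (1 / 2 : ℝ)).add continuous_const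
  · refine ((hA₂ t ht).sub (hA₁ t ht)).congr_deriv ?_
    have h1 : (A₁ t)ᵀ = A₁ t := hsymm₁ t ht
    have h2 : (A₂ t)ᵀ = A₂ t := hsymm₂ t ht
    have h3 : Mᵀ = M := hM
    simp only [transpose_add, transpose_smul, transpose_mul, h1, h2, h3, Matrix.mul_add,
      Matrix.add_mul, Matrix.mul_sub, Matrix.sub_mul, Matrix.mul_smul, Matrix.smul_mul,
      ← Matrix.mul_assoc]
    module

/-- (Theorem 5.2, final assertion.) For `γ > 1`, with
`Σ^S = L^S(L^S)ᵀ ≻ 0`, `Σ^X = L^X(L^X)ᵀ`, `Σ^{S,X} = L^S(L^X)ᵀ`, let `A⁽ⁱ⁾` (`i = 1,2`) be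
symmetric solutions on `[0,T]` of the constant-coefficient Riccati equation
`A' + ((1−γ)/γ) βᵀ(Σ^S)⁻¹β + A(Σ^X + ((1−γ)/γ)(Σ^{S,X})ᵀ(Σ^S)⁻¹Σ^{S,X})A
  + A(((1−γ)/γ)(Σ^{S,X})ᵀ(Σ^S)⁻¹β − Θ) + (((1−γ)/γ)(Σ^{S,X})ᵀ(Σ^S)⁻¹β − Θ)ᵀA = 0`
with terminal conditions `A⁽ⁱ⁾(T) = −PᵀΩᵢ⁻¹P` for symmetric positive definite `Ωᵢ`.
Then each `A⁽ⁱ⁾(t)` is negative semidefinite on `[0,T]`, and if `Ω₁⁻¹ − Ω₂⁻¹ ⪰ 0` then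
`A⁽¹⁾(t) − A⁽²⁾(t)` is negative semidefinite on `[0,T]`. -/
theorem views_precision_monotone_riccati {N N' d K : ℕ}
    (γ : ℝ) (hγ : 1 < γ)
    (LS : Matrix (Fin N) (Fin N') ℝ) (LX : Matrix (Fin d) (Fin N') ℝ)
    (SigS : Matrix (Fin N) (Fin N) ℝ) (hSigS : SigS = LS * LSᵀ)
    (hSigSpd : SigS.PosDef)
    (SigX : Matrix (Fin d) (Fin d) ℝ) (hSigX : SigX = LX * LXᵀ)
    (SigSX : Matrix (Fin N) (Fin d) ℝ) (hSigSX : SigSX = LS * LXᵀ)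
    (β : Matrix (Fin N) (Fin d) ℝ) (Θ : Matrix (Fin d) (Fin d) ℝ)
    (P : Matrix (Fin K) (Fin d) ℝ) (T : ℝ) (hT : 0 < T)
    (Ω₁ Ω₂ : Matrix (Fin K) (Fin K) ℝ) (hΩ₁ : Ω₁.PosDef) (hΩ₂ : Ω₂.PosDef)
    (A₁ A₂ : ℝ → Matrix (Fin d) (Fin d) ℝ)
    (hA₁symm : ∀ t ∈ Set.Icc (0:ℝ) T, (A₁ t).IsSymm)
    (hA₂symm : ∀ t ∈ Set.Icc (0:ℝ) T, (A₂ t).IsSymm)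
    (hA₁ode : ∀ t ∈ Set.Icc (0:ℝ) T,
      HasDerivWithinAt A₁
        (-(((1 - γ)/γ) • (βᵀ * SigS⁻¹ * β)
          + A₁ t * (SigX + ((1 - γ)/γ) • (SigSXᵀ * SigS⁻¹ * SigSX)) * A₁ t
          + A₁ t * (((1 - γ)/γ) • (SigSXᵀ * SigS⁻¹ * β) - Θ)
          + (((1 - γ)/γ) • (SigSXᵀ * SigS⁻¹ * β) - Θ)ᵀ * A₁ t))
        (Set.Icc 0 T) t)
    (hA₂ode : ∀ t ∈ Set.Icc (0:ℝ) T,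
      HasDerivWithinAt A₂
        (-(((1 - γ)/γ) • (βᵀ * SigS⁻¹ * β)
          + A₂ t * (SigX + ((1 - γ)/γ) • (SigSXᵀ * SigS⁻¹ * SigSX)) * A₂ t
          + A₂ t * (((1 - γ)/γ) • (SigSXᵀ * SigS⁻¹ * β) - Θ)
          + (((1 - γ)/γ) • (SigSXᵀ * SigS⁻¹ * β) - Θ)ᵀ * A₂ t))
        (Set.Icc 0 T) t)
    (hA₁T : A₁ T = -(Pᵀ * Ω₁⁻¹ * P))
    (hA₂T : A₂ T = -(Pᵀ * Ω₂⁻¹ * P)) :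
    (∀ t ∈ Set.Icc (0:ℝ) T, (-(A₁ t)).PosSemidef) ∧
      (∀ t ∈ Set.Icc (0:ℝ) T, (-(A₂ t)).PosSemidef) ∧
      ((Ω₁⁻¹ - Ω₂⁻¹).PosSemidef →
        ∀ t ∈ Set.Icc (0:ℝ) T, (-(A₁ t - A₂ t)).PosSemidef) := by
  have hk : 0 ≤ -((1 - γ) / γ) := by
    rw [← neg_div]
    exact div_nonneg (by linarith) (by linarith)
  have hinv : SigS⁻¹ᵀ = SigS⁻¹ := by
    simpa [conjTranspose_eq_transpose_of_trivial] using hSigSpd.inv.isHermitian.eq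
  have hM : (SigX + ((1 - γ)/γ) • (SigSXᵀ * SigS⁻¹ * SigSX)).IsSymm := by
    simp only [IsSymm, hSigX, transpose_add, transpose_smul, transpose_mul, transpose_transpose,
      hinv, Matrix.mul_assoc]
  have hQ : (-(((1 - γ)/γ) • (βᵀ * SigS⁻¹ * β))).PosSemidef := by
    rw [← neg_smul, ← conjTranspose_eq_transpose_of_trivial]
    exact (hSigSpd.inv.posSemidef.conjTranspose_mul_mul_same β).smul hk
  have hterm : ∀ W : Matrix (Fin K) (Fin K) ℝ, W.PosSemidef → (Pᵀ * W * P).PosSemidef := by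
    intro W hW
    rw [← conjTranspose_eq_transpose_of_trivial]
    exact hW.conjTranspose_mul_mul_same P
  refine ⟨posSemidef_neg_of_riccati hA₁symm hM hQ hA₁ode ?_,
    posSemidef_neg_of_riccati hA₂symm hM hQ hA₂ode ?_, fun h t ht => ?_⟩
  · rw [hA₁T, neg_neg]
    exact hterm _ hΩ₁.inv.posSemidef
  · rw [hA₂T, neg_neg]
    exact hterm _ hΩ₂.inv.posSemidef
  · rw [neg_sub]
    refine posSemidef_sub_of_riccati hA₁symm hA₂symm hM hA₁ode hA₂ode ?_ t ht
    have : A₂ T - A₁ T = Pᵀ * (Ω₁⁻¹ - Ω₂⁻¹) * P := by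
      rw [hA₁T, hA₂T, Matrix.mul_sub, Matrix.sub_mul]
      abel
    rw [this]
    exact hterm _ h
end

section
/- Let θ > 0, ω > 0, T > 0. Define δ := ln(1 + ω²)/(2θ), σ²(u) := (1 − e^{−2θu})/(2θ) for u > 0, and τ² := ω²/(2θ). Then σ²(T) − e^{−2θδ} · σ²(T)² / σ²(T+δ) = σ²(T) · τ² / (σ²(T) + τ²). -/
/-- (Proposition 4.3, variance matching.) For `θ, ω, T > 0`, with
`δ = ln(1+ω²)/(2θ)`, `σ²(u) = (1 − e^{−2θu})/(2θ)`, `τ² = ω²/(2θ)`: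
`σ²(T) − e^{−2θδ} σ²(T)² / σ²(T+δ) = σ²(T) τ² / (σ²(T) + τ²)`. -/
theorem mrb_noisy_view_variance_matching (θ ω T : ℝ)
    (hθ : 0 < θ) (hω : 0 < ω) (hT : 0 < T) :
    (1 - Real.exp (-2 * θ * T)) / (2 * θ)
        - Real.exp (-2 * θ * (Real.log (1 + ω ^ 2) / (2 * θ)))
          * ((1 - Real.exp (-2 * θ * T)) / (2 * θ)) ^ 2
          / ((1 - Real.exp (-2 * θ * (T + Real.log (1 + ω ^ 2) / (2 * θ)))) / (2 * θ))
      = ((1 - Real.exp (-2 * θ * T)) / (2 * θ)) * (ω ^ 2 / (2 * θ))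
          / ((1 - Real.exp (-2 * θ * T)) / (2 * θ) + ω ^ 2 / (2 * θ)) := by
  have hpos : 0 < 1 + ω ^ 2 := by positivity
  have hδ : Real.exp (-2 * θ * (Real.log (1 + ω ^ 2) / (2 * θ))) = (1 + ω ^ 2)⁻¹ := by
    rw [show -2 * θ * (Real.log (1 + ω ^ 2) / (2 * θ)) = -Real.log (1 + ω ^ 2) by field_simp,
      Real.exp_neg, Real.exp_log hpos]
  have hlt : Real.exp (-2 * θ * T) < 1 := Real.exp_lt_one_iff.2 (by nlinarith [mul_pos hθ hT])
  rw [mul_add, Real.exp_add, hδ]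
  generalize Real.exp (-2 * θ * T) = a at hlt ⊢
  have hne : 1 + ω ^ 2 - a ≠ 0 := ne_of_gt (by linarith [sq_nonneg ω])
  have hvar : (1 - a * (1 + ω ^ 2)⁻¹) / (2 * θ)
      = (1 + ω ^ 2 - a) / ((1 + ω ^ 2) * (2 * θ)) := by
    field_simp
  have hsum : (1 - a) / (2 * θ) + ω ^ 2 / (2 * θ) = (1 + ω ^ 2 - a) / (2 * θ) := by
    ring
  rw [hvar, hsum]
  field_simp
  ring
end

section
/- Let θ > 0 and 0 ≤ s ≤ t ≤ T with T > 0, and define c(u,v) := e^{−θ(u+v)}(e^{2θ·min(u,v)} − 1)/(2θ) for u, v ≥ 0. Then c(t,s) − c(t,T)·c(s,T)/c(T,T) = ((1 − e^{−2θ(T−t)})/(1 − e^{−2θT})) · c(t,s). -/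
/-- (Proposition 4.2, item 4.) For `θ > 0` and `0 ≤ s ≤ t ≤ T`, `T > 0`,
with `c(u,v) = e^{−θ(u+v)}(e^{2θ min(u,v)} − 1)/(2θ)` the OU covariance:
`c(t,s) − c(t,T) c(s,T)/c(T,T) = ((1 − e^{−2θ(T−t)})/(1 − e^{−2θT})) c(t,s)`. -/
theorem mrb_bridge_covariance (θ s t T : ℝ)
    (hθ : 0 < θ) (hs : 0 ≤ s) (hst : s ≤ t) (htT : t ≤ T) (hT : 0 < T)
    (c : ℝ → ℝ → ℝ)
    (hc : ∀ u v, c u v = Real.exp (-θ * (u + v)) * (Real.exp (2 * θ * min u v) - 1) / (2 * θ)) :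
    c t s - c t T * c s T / c T T
      = ((1 - Real.exp (-2 * θ * (T - t))) / (1 - Real.exp (-2 * θ * T))) * c t s := by
  have h_inv (u v : ℝ) :
      Real.exp (-θ * (u + v)) = (Real.exp (θ * u) * Real.exp (θ * v))⁻¹ := by
    rw [← Real.exp_add, ← Real.exp_neg]
    ring_nf
  have h_sq (u : ℝ) : Real.exp (2 * θ * u) = Real.exp (θ * u) ^ 2 := by
    rw [← Real.exp_nat_mul]
    push_cast
    ring_nf
  have h_diff : Real.exp (-2 * θ * (T - t)) = Real.exp (θ * t) ^ 2 / Real.exp (θ * T) ^ 2 := by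
    rw [← h_sq, ← h_sq, ← Real.exp_sub]
    ring_nf
  have h_neg : Real.exp (-2 * θ * T) = (Real.exp (θ * T) ^ 2)⁻¹ := by
    rw [← h_sq, ← Real.exp_neg]
    ring_nf
  have h_pos : Real.exp (θ * T) ^ 2 - 1 ≠ 0 := by
    have h_one : 1 < Real.exp (θ * T) := Real.one_lt_exp_iff.mpr (mul_pos hθ hT)
    nlinarith
  have h_quot : 1 - (Real.exp (θ * T) ^ 2)⁻¹
      = (Real.exp (θ * T) ^ 2 - 1) / Real.exp (θ * T) ^ 2 := by
    field_simp
  simp only [hc, min_eq_right hst, min_eq_left htT, min_eq_left (hst.trans htT), min_self,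
    h_inv, h_sq, h_diff, h_neg, h_quot]
  have ha := Real.exp_ne_zero (θ * s)
  have hb := Real.exp_ne_zero (θ * t)
  have hd := Real.exp_ne_zero (θ * T)
  generalize Real.exp (θ * s) = a at *
  generalize Real.exp (θ * t) = b at *
  generalize Real.exp (θ * T) = d at *
  field_simp
  ring
end
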